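/- For every complete multipartite graph K_{r_1,…,r_k} with k ≥ 3 parts such that every part size satisfies r_j ≥ 2 and r_j ≠ 3, and whose total number of vertices n = r_1 + … + r_k is even, the game chromatic number satisfies χ_g(K_{r_1,…,r_k}) ≥ 2k − 1. -/

import Mathlib

/-- A color `c` is legal for vertex `v` in partial coloring `f` if no neighbor of `v`
is already colored with `c`. -/
def legalColor {V C : Type} (G : SimpleGraph V) (f : V → Option C) (v : V) (c : C) : Prop :=
  ∀ w, G.Adj v w → f w ≠ some c

/-- A move in the coloring game: choose an uncolored vertex and color it with a legal color. -/
def gameMove {V C : Type} [DecidableEq V] (G : SimpleGraph V) (f f' : V → Option C) : Prop :=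
  ∃ v c, f v = none ∧ legalColor G f v c ∧ f' = Function.update f v (some c)

/-- Every vertex is colored. -/
def isFull {V C : Type} (f : V → Option C) : Prop := ∀ v, (f v).isSome

/-- Some uncolored vertex has no legal color (then Bob wins). -/
def isStuck {V C : Type} (G : SimpleGraph V) (f : V → Option C) : Prop :=
  ∃ v, f v = none ∧ ∀ c, ¬ legalColor G f v c

/-- It is Alice's turn when an even number of vertices are colored
(Alice moves first, and each move colors exactly one vertex). -/
def aliceTurn {V C : Type} [Fintype V] (f : V → Option C) : Prop :=
  Even (Finset.univ.filter (fun v => (f v).isSome = true)).card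

/-- Alice has a winning strategy from position `f` when `n` vertices remain uncolored:
Alice wins exactly the plays in which the entire graph gets colored; as soon as some
uncolored vertex has no legal color, Bob wins. -/
def aliceWinsFrom {V C : Type} [Fintype V] [DecidableEq V] (G : SimpleGraph V) :
    ℕ → (V → Option C) → Prop
  | 0, f => isFull f
  | n + 1, f => isFull f ∨ (¬ isStuck G f ∧
      ((aliceTurn f ∧ ∃ f', gameMove G f f' ∧ aliceWinsFrom G n f') ∨
       (¬ aliceTurn f ∧ ∀ f', gameMove G f f' → aliceWinsFrom G n f')))

/-- Alice has a winning strategy in the graph coloring game on `G` with `m` colors. -/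
def aliceWins {V : Type} [Fintype V] [DecidableEq V] (G : SimpleGraph V) (m : ℕ) : Prop :=
  aliceWinsFrom (C := Fin m) G (Fintype.card V) (fun _ => none)

/-- The game chromatic number: the least number of colors for which Alice has
a winning strategy. -/
noncomputable def gameChromaticNumber {V : Type} [Fintype V] [DecidableEq V]
    (G : SimpleGraph V) : ℕ :=
  sInf {m | aliceWins G m}

/-- The complete multipartite graph `K_{r 0, …, r (k-1)}`. -/
def K (k : ℕ) (r : Fin k → ℕ) : SimpleGraph (Σ i : Fin k, Fin (r i)) :=
  SimpleGraph.completeMultipartiteGraph (fun i => Fin (r i))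

section Potential

variable {k m : ℕ} {r : Fin k → ℕ}

/-- A position of the coloring game on `K k r` with `m` colors. -/
abbrev Position (k m : ℕ) (r : Fin k → ℕ) : Type := (Σ i : Fin k, Fin (r i)) → Option (Fin m)

open Classical in
/-- The parts in which no vertex is colored. -/
noncomputable def untouchedParts (f : Position k m r) : Finset (Fin k) :=
  Finset.univ.filter fun i => ∀ j, f ⟨i, j⟩ = none

open Classical in
/-- The colors not yet used on any vertex. -/
noncomputable def freeColors (f : Position k m r) : Finset (Fin m) :=
  Finset.univ.filter fun c => ∀ v, f v ≠ some c

open Classical in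
/-- The uncolored vertices lying in a part that already contains a colored vertex. -/
noncomputable def openVertices (f : Position k m r) : Finset (Σ i : Fin k, Fin (r i)) :=
  Finset.univ.filter fun v => f v = none ∧ v.1 ∉ untouchedParts f

/-- The uncolored vertices. -/
def uncolored {V C : Type} [Fintype V] (f : V → Option C) : Finset V :=
  Finset.univ.filter fun v => (f v).isSome = false

theorem mem_untouchedParts {f : Position k m r} {i : Fin k} :
    i ∈ untouchedParts f ↔ ∀ j, f ⟨i, j⟩ = none := by
  simp [untouchedParts]

theorem mem_freeColors {f : Position k m r} {c : Fin m} :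
    c ∈ freeColors f ↔ ∀ v, f v ≠ some c := by
  simp [freeColors]

theorem mem_openVertices {f : Position k m r} {v : Σ i : Fin k, Fin (r i)} :
    v ∈ openVertices f ↔ f v = none ∧ v.1 ∉ untouchedParts f := by
  simp [openVertices]

theorem mem_uncolored {V C : Type} [Fintype V] {f : V → Option C} {v : V} :
    v ∈ uncolored f ↔ f v = none := by
  simp [uncolored]

theorem card_uncolored_update {V C : Type} [Fintype V] [DecidableEq V] {f : V → Option C}
    {v : V} (hv : f v = none) (c : C) :
    (uncolored (Function.update f v (some c))).card + 1 = (uncolored f).card := by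
  have h : uncolored (Function.update f v (some c)) = (uncolored f).erase v := by
    ext w
    by_cases hw : w = v <;> simp [mem_uncolored, hw]
  rw [h, Finset.card_erase_add_one (mem_uncolored.2 hv)]

theorem card_colored_add_card_uncolored {V C : Type} [Fintype V] (f : V → Option C) :
    (Finset.univ.filter (fun v => (f v).isSome = true)).card + (uncolored f).card =
      Fintype.card V := by
  rw [← Finset.card_univ, ← Finset.card_filter_add_card_filter_not
    (s := Finset.univ) (fun v => (f v).isSome = true)]
  simp [uncolored]

theorem card_uncolored_eq (f : Position k m r) :
    (uncolored f).card = (openVertices f).card + ∑ i ∈ untouchedParts f, r i := by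
  classical
  have h : uncolored f =
      openVertices f ∪ (untouchedParts f).sigma (fun i => (Finset.univ : Finset (Fin (r i)))) := by
    ext ⟨i, j⟩
    simp only [mem_uncolored, Finset.mem_union, mem_openVertices, Finset.mem_sigma,
      Finset.mem_univ, and_true]
    by_cases hi : i ∈ untouchedParts f
    · simp [hi, mem_untouchedParts.1 hi j]
    · simp [hi]
  rw [h, Finset.card_union_of_disjoint, Finset.card_sigma]
  · simp
  · rw [Finset.disjoint_left]
    intro v hv hv'
    exact (mem_openVertices.1 hv).2 (Finset.mem_sigma.1 hv').1

theorem freeColors_update {f : Position k m r} {v : Σ i : Fin k, Fin (r i)} (hv : f v = none)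
    (c : Fin m) : freeColors (Function.update f v (some c)) = (freeColors f).erase c := by
  ext d
  simp only [mem_freeColors, Finset.mem_erase]
  constructor
  · refine fun h => ⟨fun hd => h v (by simp [hd]), fun w => ?_⟩
    by_cases hw : w = v
    · simp [hw, hv]
    · simpa [hw] using h w
  · rintro ⟨hd, h⟩ w
    by_cases hw : w = v
    · simp [hw, Ne.symm hd]
    · simpa [hw] using h w

theorem untouchedParts_update (f : Position k m r) (v : Σ i : Fin k, Fin (r i)) (c : Fin m) :
    untouchedParts (Function.update f v (some c)) = (untouchedParts f).erase v.1 := by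
  ext i
  simp only [mem_untouchedParts, Finset.mem_erase]
  constructor
  · refine fun h => ⟨?_, fun j => ?_⟩
    · rintro rfl
      simpa using h v.2
    · by_cases hw : (⟨i, j⟩ : Σ i : Fin k, Fin (r i)) = v
      · have := h j
        simp [hw] at this
      · simpa [hw] using h j
  · rintro ⟨hi, h⟩ j
    have hw : (⟨i, j⟩ : Σ i : Fin k, Fin (r i)) ≠ v := fun hw => hi (by simp [← hw])
    simpa [hw] using h j

theorem update_of_mem_openVertices {f : Position k m r} {v : Σ i : Fin k, Fin (r i)}
    (hv : v ∈ openVertices f) (c : Fin m) :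
    (untouchedParts (Function.update f v (some c))).card = (untouchedParts f).card ∧
    (openVertices (Function.update f v (some c))).card + 1 = (openVertices f).card := by
  obtain ⟨hv, hi⟩ := mem_openVertices.1 hv
  have hU : untouchedParts (Function.update f v (some c)) = untouchedParts f := by
    rw [untouchedParts_update, Finset.erase_eq_of_notMem hi]
  have h₁ := card_uncolored_update hv c
  have h₂ := card_uncolored_eq f
  have h₃ := card_uncolored_eq (Function.update f v (some c))
  rw [hU] at h₃
  exact ⟨by rw [hU], by omega⟩

theorem update_of_mem_untouchedParts {f : Position k m r} {v : Σ i : Fin k, Fin (r i)}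
    (hv : v.1 ∈ untouchedParts f) (c : Fin m) :
    (untouchedParts (Function.update f v (some c))).card + 1 = (untouchedParts f).card ∧
    (openVertices (Function.update f v (some c))).card + 1 =
      (openVertices f).card + r v.1 := by
  have hv' : f v = none := mem_untouchedParts.1 hv v.2
  have h₁ := card_uncolored_update hv' c
  have h₂ := card_uncolored_eq f
  have h₃ := card_uncolored_eq (Function.update f v (some c))
  have h₄ := Finset.sum_erase_add _ r hv
  rw [untouchedParts_update] at h₃
  exact ⟨by rw [untouchedParts_update, Finset.card_erase_add_one hv], by omega⟩

theorem gameMove_cases {f f' : Position k m r} (h : gameMove (K k r) f f') :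
    ((untouchedParts f').card = (untouchedParts f).card ∧
      (openVertices f').card + 1 = (openVertices f).card ∧
      (freeColors f').card ≤ (freeColors f).card) ∨
    ∃ i, (untouchedParts f').card + 1 = (untouchedParts f).card ∧
      (openVertices f').card + 1 = (openVertices f).card + r i ∧
      (freeColors f').card + 1 = (freeColors f).card := by
  obtain ⟨v, c, hv, hc, rfl⟩ := h
  by_cases hi : v.1 ∈ untouchedParts f
  · refine Or.inr ⟨v.1, (update_of_mem_untouchedParts hi c).1,
      (update_of_mem_untouchedParts hi c).2, ?_⟩
    have hcF : c ∈ freeColors f := by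
      rw [mem_freeColors]
      intro w
      by_cases hw : v.1 = w.1
      · have := mem_untouchedParts.1 hi
        rw [hw] at this
        simp [this w.2]
      · exact hc w hw
    rw [freeColors_update hv, Finset.card_erase_add_one hcF]
  · have hT := mem_openVertices.2 ⟨hv, hi⟩
    refine Or.inl ⟨(update_of_mem_openVertices hT c).1, (update_of_mem_openVertices hT c).2, ?_⟩
    rw [freeColors_update hv]
    exact Finset.card_erase_le

theorem exists_gameMove_openVertices {f : Position k m r} (hT : 0 < (openVertices f).card)
    (hF : 0 < (freeColors f).card) :
    ∃ f', gameMove (K k r) f f' ∧ (untouchedParts f').card = (untouchedParts f).card ∧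
      (openVertices f').card + 1 = (openVertices f).card ∧
      (freeColors f').card + 1 = (freeColors f).card := by
  obtain ⟨v, hv⟩ := Finset.card_pos.1 hT
  obtain ⟨c, hc⟩ := Finset.card_pos.1 hF
  have hv' := (mem_openVertices.1 hv).1
  refine ⟨_, ⟨v, c, hv', fun w _ => mem_freeColors.1 hc w, rfl⟩,
    (update_of_mem_openVertices hv c).1, (update_of_mem_openVertices hv c).2, ?_⟩
  rw [freeColors_update hv', Finset.card_erase_add_one hc]

theorem exists_gameMove_untouchedParts {f : Position k m r} {i : Fin k}
    (hi : i ∈ untouchedParts f) (hr : 0 < r i) (hF : 0 < (freeColors f).card) :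
    ∃ f', gameMove (K k r) f f' ∧ (untouchedParts f').card + 1 = (untouchedParts f).card ∧
      (openVertices f').card + 1 = (openVertices f).card + r i ∧
      (freeColors f').card + 1 = (freeColors f).card := by
  obtain ⟨c, hc⟩ := Finset.card_pos.1 hF
  let v : Σ i : Fin k, Fin (r i) := ⟨i, ⟨0, hr⟩⟩
  have hv : f v = none := mem_untouchedParts.1 hi _
  have hvi : v.1 ∈ untouchedParts f := hi
  refine ⟨_, ⟨v, c, hv, fun w _ => mem_freeColors.1 hc w, rfl⟩,
    (update_of_mem_untouchedParts hvi c).1, (update_of_mem_untouchedParts hvi c).2, ?_⟩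
  rw [freeColors_update hv, Finset.card_erase_add_one hc]

theorem aliceTurn_gameMove {V C : Type} [Fintype V] [DecidableEq V] {G : SimpleGraph V}
    {f f' : V → Option C} (h : gameMove G f f') : aliceTurn f' ↔ ¬ aliceTurn f := by
  obtain ⟨v, c, hv, -, rfl⟩ := h
  have h₁ := card_uncolored_update hv c
  have h₂ := card_colored_add_card_uncolored f
  have h₃ := card_colored_add_card_uncolored (Function.update f v (some c))
  unfold aliceTurn
  rw [Nat.even_iff, Nat.even_iff]
  omega

/-- Numerical conditions, in the numbers `u` of untouched parts, `t` of uncolored vertices in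
touched parts and `c` of free colors, under which Bob wins with Alice to move. -/
def BobWinsAliceToMove (u t c : ℕ) : Prop := c + 2 ≤ 2 * u ∧ (t = 1 → c + 3 ≤ 2 * u)

/-- Numerical conditions, in the numbers `u` of untouched parts, `t` of uncolored vertices in
touched parts and `c` of free colors, under which Bob wins with Bob to move. -/
def BobWinsBobToMove (u t c : ℕ) : Prop :=
  c + 1 ≤ 2 * u ∧ (t = 2 → c + 2 ≤ 2 * u) ∧ (t = 0 → c + 3 ≤ 2 * u)

/-- A sufficient condition for Bob to win from the position `f`. -/
def BobWinning (f : Position k m r) : Prop :=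
  (freeColors f).card < (untouchedParts f).card ∨
  (aliceTurn f ∧
    BobWinsAliceToMove (untouchedParts f).card (openVertices f).card (freeColors f).card) ∨
  (¬ aliceTurn f ∧
    BobWinsBobToMove (untouchedParts f).card (openVertices f).card (freeColors f).card)

theorem BobWinning.not_isFull {f : Position k m r} (h : BobWinning f) (h2 : ∀ j, 2 ≤ r j) :
    ¬ isFull f := by
  intro hf
  have hU : 0 < (untouchedParts f).card := by
    unfold BobWinning BobWinsAliceToMove BobWinsBobToMove at h
    omega
  obtain ⟨i, hi⟩ := Finset.card_pos.1 hU
  have := hf ⟨i, ⟨0, by have := h2 i; omega⟩⟩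
  simp [mem_untouchedParts.1 hi] at this

theorem BobWinning.of_card_lt {f f' : Position k m r} (hmove : gameMove (K k r) f f')
    (h : (freeColors f).card < (untouchedParts f).card) : BobWinning f' := by
  left
  rcases gameMove_cases hmove with h' | ⟨i, h'⟩ <;> omega

theorem BobWinning.alice_move {f f' : Position k m r} (h : BobWinning f) (hturn : aliceTurn f)
    (h2 : ∀ j, 2 ≤ r j) (hne3 : ∀ j, r j ≠ 3) (hmove : gameMove (K k r) f f') :
    BobWinning f' := by
  rcases h with h | ⟨-, h⟩ | ⟨h, -⟩
  · exact BobWinning.of_card_lt hmove h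
  · have hturn' : ¬ aliceTurn f' := by simpa [aliceTurn_gameMove hmove] using hturn
    refine Or.inr (Or.inr ⟨hturn', ?_⟩)
    unfold BobWinsAliceToMove at h
    unfold BobWinsBobToMove
    rcases gameMove_cases hmove with h' | ⟨i, h'⟩
    · omega
    · have := h2 i
      have := hne3 i
      omega
  · exact absurd hturn h

theorem exists_mem_untouchedParts_odd {f : Position k m r} (heven : Even (∑ i, r i))
    (hturn : ¬ aliceTurn f) (hT : (openVertices f).card = 0) :
    ∃ i ∈ untouchedParts f, Odd (r i) := by
  by_contra! hcon
  have h₁ : Even (∑ i ∈ untouchedParts f, r i) :=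
    Finset.even_sum _ fun i hi => by simpa using hcon i hi
  have h₂ := card_colored_add_card_uncolored f
  have h₃ := card_uncolored_eq f
  simp only [Fintype.card_sigma, Fintype.card_fin] at h₂
  unfold aliceTurn at hturn
  rw [Nat.even_iff] at *
  omega

theorem BobWinning.exists_bob_move {f : Position k m r} (h : BobWinning f)
    (hturn : ¬ aliceTurn f) (hstuck : ¬ isStuck (K k r) f) (h2 : ∀ j, 2 ≤ r j)
    (hne3 : ∀ j, r j ≠ 3) (heven : Even (∑ i, r i)) :
    ∃ f', gameMove (K k r) f f' ∧ BobWinning f' := by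
  by_cases hlt : (freeColors f).card < (untouchedParts f).card
  · have hfull := h.not_isFull h2
    simp only [isFull, not_forall, Bool.not_eq_true, Option.isSome_eq_false_iff,
      Option.isNone_iff_eq_none] at hfull
    obtain ⟨v, hv⟩ := hfull
    simp only [isStuck, not_exists, not_and, not_forall, not_not] at hstuck
    obtain ⟨c, hc⟩ := hstuck v hv
    have hmove : gameMove (K k r) f (Function.update f v (some c)) := ⟨v, c, hv, hc, rfl⟩
    exact ⟨_, hmove, BobWinning.of_card_lt hmove hlt⟩
  · rcases h with h | ⟨h, -⟩ | ⟨-, h⟩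
    · exact absurd h hlt
    · exact absurd h hturn
    unfold BobWinsBobToMove at h
    have hF : 0 < (freeColors f).card := by omega
    rcases Nat.eq_zero_or_pos (openVertices f).card with hT | hT
    · obtain ⟨i, hi, hodd⟩ := exists_mem_untouchedParts_odd heven hturn hT
      have := h2 i
      have := hne3 i
      obtain ⟨f', hmove, h'⟩ := exists_gameMove_untouchedParts hi (by omega) hF
      refine ⟨f', hmove, Or.inr (Or.inl ⟨(aliceTurn_gameMove hmove).2 hturn, ?_⟩)⟩
      unfold BobWinsAliceToMove
      rw [Nat.odd_iff] at hodd
      omega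
    · obtain ⟨f', hmove, h'⟩ := exists_gameMove_openVertices hT hF
      refine ⟨f', hmove, Or.inr (Or.inl ⟨(aliceTurn_gameMove hmove).2 hturn, ?_⟩)⟩
      unfold BobWinsAliceToMove
      omega

theorem BobWinning.not_aliceWinsFrom (h2 : ∀ j, 2 ≤ r j) (hne3 : ∀ j, r j ≠ 3)
    (heven : Even (∑ i, r i)) (n : ℕ) {f : Position k m r} (h : BobWinning f) :
    ¬ aliceWinsFrom (K k r) n f := by
  induction n generalizing f with
  | zero => exact h.not_isFull h2
  | succ n ih =>
    rintro (hfull | ⟨hstuck, ⟨hturn, f', hmove, hwin⟩ | ⟨hturn, hwin⟩⟩)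
    · exact h.not_isFull h2 hfull
    · exact ih (h.alice_move hturn h2 hne3 hmove) hwin
    · obtain ⟨f', hmove, h'⟩ := h.exists_bob_move hturn hstuck h2 hne3 heven
      exact ih h' (hwin f' hmove)

end Potential

theorem exists_unused_color {V : Type} [Fintype V] {f : V → Option (Fin (Fintype.card V))}
    {v : V} (hv : f v = none) : ∃ c, ∀ w, f w ≠ some c := by
  by_contra! hcon
  choose g hg using hcon
  have hinj : Function.Injective g := fun a b hab =>
    Option.some_injective _ (by rw [← hg a, ← hg b, hab])
  have hsurj : Function.Surjective g :=
    ((Fintype.bijective_iff_injective_and_card g).2 ⟨hinj, by simp⟩).2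
  obtain ⟨c, rfl⟩ := hsurj v
  simp [hg] at hv

theorem aliceWinsFrom_card_uncolored {V : Type} [Fintype V] [DecidableEq V] (G : SimpleGraph V)
    (n : ℕ) {f : V → Option (Fin (Fintype.card V))} (hf : (uncolored f).card = n) :
    aliceWinsFrom G n f := by
  induction n generalizing f with
  | zero =>
    intro v
    by_contra hv
    rw [Finset.card_eq_zero] at hf
    have : v ∈ uncolored f := mem_uncolored.2 (by simpa using hv)
    simp [hf] at this
  | succ n ih =>
    have hnext : ∀ f', gameMove G f f' → aliceWinsFrom G n f' := by
      rintro _ ⟨v, c, hv, -, rfl⟩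
      have := card_uncolored_update hv c
      exact ih (by omega)
    refine Or.inr ⟨?_, ?_⟩
    · rintro ⟨v, hv, hc⟩
      obtain ⟨c, hc'⟩ := exists_unused_color hv
      exact hc c fun w _ => hc' w
    · by_cases hturn : aliceTurn f
      · obtain ⟨v, hv⟩ : (uncolored f).Nonempty := Finset.card_pos.1 (by omega)
        rw [mem_uncolored] at hv
        obtain ⟨c, hc⟩ := exists_unused_color hv
        have hmove : gameMove G f (Function.update f v (some c)) :=
          ⟨v, c, hv, fun w _ => hc w, rfl⟩
        exact Or.inl ⟨hturn, _, hmove, hnext _ hmove⟩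
      · exact Or.inr ⟨hturn, hnext⟩

theorem aliceWins_card {V : Type} [Fintype V] [DecidableEq V] (G : SimpleGraph V) :
    aliceWins G (Fintype.card V) :=
  aliceWinsFrom_card_uncolored G _ (by simp [uncolored])

theorem game_chromatic_ge_of_no_three_even (k : ℕ) (hk : 3 ≤ k) (r : Fin k → ℕ)
    (hanti : Antitone r) (h2 : ∀ j, 2 ≤ r j) (hne3 : ∀ j, r j ≠ 3)
    (heven : Even (∑ i, r i)) :
    2 * k - 1 ≤ gameChromaticNumber (K k r) := by
  refine le_csInf ⟨_, aliceWins_card _⟩ fun m hm => ?_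
  by_contra hlt
  refine BobWinning.not_aliceWinsFrom h2 hne3 heven _ (Or.inr (Or.inl ⟨?_, ?_⟩)) hm
  · simp [aliceTurn]
  · have hU : (untouchedParts (fun _ => none : Position k m r)).card = k := by
      simp [untouchedParts]
    have hT : (openVertices (fun _ => none : Position k m r)).card = 0 := by
      simp [openVertices, untouchedParts]
    have hF : (freeColors (fun _ => none : Position k m r)).card = m := by
      simp [freeColors]
    rw [hU, hT, hF]
    unfold BobWinsAliceToMove
    omega
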